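/- Let $K$ be a field, $n\geq 2$, and $f\in[M_n,M_n]$. The endomorphism $(x_1+f,x_2,\ldots,x_n)$ of the free metabelian Lie algebra $M_n$ is an automorphism if and only if $f$ belongs to the Lie ideal of $M_n$ generated by all elements $[x_s,x_t]$ with $2\leq s,t\leq n$. -/

import Mathlib

noncomputable section

/-- The free metabelian Lie algebra of rank `n` over `K`: the quotient of the free Lie
algebra on `n` generators by its second derived ideal. -/
abbrev FreeMetabelianLie (K : Type) [Field K] (n : ℕ) : Type :=
  FreeLieAlgebra K (Fin n) ⧸ LieAlgebra.derivedSeries K (FreeLieAlgebra K (Fin n)) 2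

/-- The free generators `x₁, …, xₙ` of the free metabelian Lie algebra. -/
def xg (K : Type) [Field K] (n : ℕ) (i : Fin n) : FreeMetabelianLie K n :=
  LieSubmodule.Quotient.mk (N := LieAlgebra.derivedSeries K (FreeLieAlgebra K (Fin n)) 2)
    (FreeLieAlgebra.of K i)

/-- The group structure on Lie algebra automorphisms, with `(e * f) x = e (f x)`. -/
instance lieAutGroup (K : Type) [CommRing K] (L : Type) [LieRing L] [LieAlgebra K L] :
    Group (L ≃ₗ⁅K⁆ L) where
  mul e f := f.trans e
  one := LieEquiv.refl
  inv := LieEquiv.symm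
  mul_assoc _ _ _ := LieEquiv.ext fun _ => rfl
  one_mul _ := LieEquiv.ext fun _ => rfl
  mul_one _ := LieEquiv.ext fun _ => rfl
  inv_mul_cancel e := LieEquiv.ext fun x => e.symm_apply_apply x

/-- An automorphism of the free metabelian Lie algebra is elementary if it maps some `xᵢ` to
`α • xᵢ + f`, with `0 ≠ α ∈ K` and `f` in the subalgebra generated by the other generators,
and fixes all other generators. -/
def IsElementaryAut (K : Type) [Field K] (n : ℕ)
    (φ : FreeMetabelianLie K n ≃ₗ⁅K⁆ FreeMetabelianLie K n) : Prop :=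
  ∃ (i : Fin n) (α : K) (f : FreeMetabelianLie K n), α ≠ 0 ∧
    f ∈ LieSubalgebra.lieSpan K (FreeMetabelianLie K n) (xg K n '' {j | j ≠ i}) ∧
    φ (xg K n i) = α • xg K n i + f ∧ ∀ j : Fin n, j ≠ i → φ (xg K n j) = xg K n j

/-- A tame automorphism is one in the subgroup generated by the elementary automorphisms. -/
def IsTame (K : Type) [Field K] (n : ℕ)
    (φ : FreeMetabelianLie K n ≃ₗ⁅K⁆ FreeMetabelianLie K n) : Prop :=
  φ ∈ Subgroup.closure {ψ | IsElementaryAut K n ψ}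

/-- A Chein automorphism (one-row transformation) moves only one generator. -/
def IsCheinAut (K : Type) [Field K] (n : ℕ)
    (φ : FreeMetabelianLie K n ≃ₗ⁅K⁆ FreeMetabelianLie K n) : Prop :=
  ∃ i : Fin n, ∀ j : Fin n, j ≠ i → φ (xg K n j) = xg K n j

/-- An almost tame automorphism is one in the subgroup generated by Chein automorphisms. -/
def IsAlmostTame (K : Type) [Field K] (n : ℕ)
    (φ : FreeMetabelianLie K n ≃ₗ⁅K⁆ FreeMetabelianLie K n) : Prop :=
  φ ∈ Subgroup.closure {ψ | IsCheinAut K n ψ}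

/-- `monoSet K n k` is the set of right-normed Lie monomials of degree `k+1` in the
generators. -/
def monoSet (K : Type) [Field K] (n : ℕ) : ℕ → Set (FreeMetabelianLie K n)
  | 0 => Set.range (xg K n)
  | k + 1 => {z | ∃ u ∈ monoSet K n k, ∃ i : Fin n, z = ⁅u, xg K n i⁆}

/-- `gradePiece K n k` (for `k ≥ 1`) is the homogeneous component `L_k` of the standard
grading: the linear span of the Lie monomials of degree `k` in the generators. -/
def gradePiece (K : Type) [Field K] (n : ℕ) (k : ℕ) : Submodule K (FreeMetabelianLie K n) :=
  Submodule.span K (monoSet K n (k - 1))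

/-- The automorphism `φ = (l₁ + m₁, …, lₙ + mₙ)` (with `lᵢ` linear, `mᵢ ∈ [M,M]`) has lower
degree `≥ d`: each `φ(xᵢ)` lies in `L₁ ⊕ (⨆ k ≥ d, L_k)`. -/
def AutLdegGE (K : Type) [Field K] (n : ℕ)
    (φ : FreeMetabelianLie K n ≃ₗ⁅K⁆ FreeMetabelianLie K n) (d : ℕ) : Prop :=
  ∀ i : Fin n, φ (xg K n i) ∈
    gradePiece K n 1 ⊔ ⨆ (k : ℕ) (_ : d ≤ k), gradePiece K n k

/-- The action of a polynomial `a ∈ U = K[y₁,…,yₙ]` on `m`; for `m ∈ [M,M]` this is the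
canonical `U`-module action on the derived ideal, determined by `m ⬝ yᵢ = ⁅m, xᵢ⁆`. -/
def polyAct (K : Type) [Field K] (n : ℕ) (a : MvPolynomial (Fin n) K)
    (m : FreeMetabelianLie K n) : FreeMetabelianLie K n :=
  ∑ d ∈ a.support, a.coeff d •
    ((List.ofFn fun i : Fin n =>
      (-(LieAlgebra.ad K (FreeMetabelianLie K n) (xg K n i))) ^ (d i)).prod m)

/-- The polynomial `a` has lower degree `≥ d`: every monomial of `a` has total degree `≥ d`. -/
def PolyLdegGE (K : Type) [Field K] (n : ℕ) (a : MvPolynomial (Fin n) K) (d : ℕ) : Prop :=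
  ∀ v ∈ a.support, d ≤ ∑ i, v i

/-- An exponential automorphism: `exp (ad z) = id + ad z` for some `z ∈ [M,M]`. -/
def IsExponentialAut (K : Type) [Field K] (n : ℕ)
    (φ : FreeMetabelianLie K n ≃ₗ⁅K⁆ FreeMetabelianLie K n) : Prop :=
  ∃ z ∈ LieAlgebra.derivedSeries K (FreeMetabelianLie K n) 1,
    ∀ m : FreeMetabelianLie K n, φ m = m + ⁅z, m⁆

end

open scoped IsMulCommutative in
/-- Pairwise commuting elements of an algebra are the values of the variables under a
homomorphism from a polynomial ring. -/
theorem MvPolynomial.exists_algHom_of_commute {ι R A : Type*} [CommRing R] [Ring A] [Algebra R A]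
    (a : ι → A) (h : ∀ i j, a i * a j = a j * a i) :
    ∃ ρ : MvPolynomial ι R →ₐ[R] A, ∀ i, ρ (MvPolynomial.X i) = a i := by
  have := Algebra.isMulCommutative_adjoin R (s := Set.range a)
    (by rintro _ ⟨i, rfl⟩ _ ⟨j, rfl⟩; exact h i j)
  refine ⟨(Algebra.adjoin R (Set.range a)).val.comp (MvPolynomial.aeval
    fun i => (⟨a i, Algebra.subset_adjoin ⟨i, rfl⟩⟩ : Algebra.adjoin R (Set.range a))), ?_⟩
  intro i
  rw [AlgHom.comp_apply, MvPolynomial.aeval_X]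
  rfl

/-- If the elements `v t`, `t ∈ T`, satisfy the Koszul relations of the variables modulo a stable
subspace `W`, then `X t ↦ v t` extends modulo `W` to the ideal generated by these variables. -/
theorem MvPolynomial.exists_linearMap_of_koszul {ι K V : Type*} [CommRing K] [AddCommGroup V]
    [Module K V] (ρ : MvPolynomial ι K →ₐ[K] Module.End K V) (W : Submodule K V)
    (hW : ∀ p, ∀ w ∈ W, ρ p w ∈ W) (T : Set ι) (v : ι → V)
    (hv : ∀ s ∈ T, ∀ t ∈ T, ρ (X s) (v t) - ρ (X t) (v s) ∈ W) :
    ∃ σ : MvPolynomial ι K →ₗ[K] V, ∀ t ∈ T, ∀ p, σ (p * X t) - ρ p (v t) ∈ W := by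
  classical
  let g : (ι →₀ ℕ) → V := fun a =>
    if h : ∃ t ∈ T, a t ≠ 0 then ρ (monomial (a - Finsupp.single h.choose 1) 1) (v h.choose) else 0
  have key : ∀ t ∈ T, ∀ a : ι →₀ ℕ,
      g (a + Finsupp.single t 1) - ρ (monomial a 1) (v t) ∈ W := by
    intro t ht a
    have h : ∃ s ∈ T, (a + Finsupp.single t 1 : ι →₀ ℕ) s ≠ 0 := ⟨t, ht, by simp⟩
    simp only [g, dif_pos h]
    obtain ⟨hsT, hs⟩ := h.choose_spec
    generalize h.choose = s at hsT hs
    by_cases hst : s = t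
    · subst hst
      simp
    · have has : a s ≠ 0 := by simpa [Finsupp.single_apply, Ne.symm hst] using hs
      obtain ⟨b, rfl⟩ : ∃ b, a = b + Finsupp.single s 1 :=
        ⟨a - Finsupp.single s 1, (tsub_add_cancel_of_le (by
          rw [Finsupp.single_le_iff]; omega)).symm⟩
      have h1 : b + Finsupp.single s 1 + Finsupp.single t 1 - Finsupp.single s 1
          = b + Finsupp.single t 1 := by
        rw [add_right_comm, add_tsub_cancel_right]
      have h2 : ∀ r, (monomial (b + Finsupp.single r 1) (1 : K)) = monomial b 1 * X r := by
        intro r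
        rw [X, monomial_mul, one_mul]
      rw [h1, h2, h2, map_mul, map_mul, Module.End.mul_apply, Module.End.mul_apply, ← map_sub]
      exact hW _ _ (hv t ht s hsT)
  refine ⟨(basisMonomials ι K).constr K g, fun t ht p => ?_⟩
  induction p using MvPolynomial.induction_on' with
  | monomial a c =>
    have h1 : (monomial a c : MvPolynomial ι K) = c • monomial a 1 := by
      rw [smul_monomial, smul_eq_mul, mul_one]
    have h2 : (monomial a (1 : K)) * X t = basisMonomials ι K (a + Finsupp.single t 1) := by
      rw [coe_basisMonomials, X, monomial_mul, one_mul]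
    rw [h1, smul_mul_assoc, h2, map_smul, map_smul, Module.Basis.constr_basis,
      LinearMap.smul_apply, ← smul_sub]
    exact W.smul_mem _ (key t ht a)
  | add p q hp hq =>
    rw [add_mul, map_add, map_add, LinearMap.add_apply, add_sub_add_comm]
    exact W.add_mem hp hq

/-- A Lie ideal containing the brackets of a generating set contains the derived ideal. -/
theorem LieIdeal.derivedSeries_one_le_of_lie_mem {R L : Type*} [CommRing R] [LieRing L]
    [LieAlgebra R L] {s : Set L} (hs : LieSubalgebra.lieSpan R L s = ⊤) (J : LieIdeal R L)
    (hJ : ∀ x ∈ s, ∀ y ∈ s, ⁅x, y⁆ ∈ J) : LieAlgebra.derivedSeries R L 1 ≤ J := by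
  have mem (x : L) : x ∈ LieSubalgebra.lieSpan R L s := hs ▸ LieSubalgebra.mem_top x
  have h1 : ∀ x : L, ∀ y ∈ s, ⁅x, y⁆ ∈ J := by
    intro x y hy
    induction mem x using LieSubalgebra.lieSpan_induction with
    | mem x hx => exact hJ x hx y hy
    | zero => simp
    | add a b _ _ ha hb => rw [add_lie]; exact add_mem ha hb
    | smul c a _ ha => rw [smul_lie]; exact J.smul_mem c ha
    | lie a b _ _ ha hb => rw [lie_lie]; exact sub_mem (J.lie_mem hb) (J.lie_mem ha)
  have h2 : ∀ x y : L, ⁅x, y⁆ ∈ J := by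
    intro x y
    induction mem y using LieSubalgebra.lieSpan_induction with
    | mem y hy => exact h1 x y hy
    | zero => simp
    | add a b _ _ ha hb => rw [lie_add]; exact add_mem ha hb
    | smul c a _ ha => rw [lie_smul]; exact J.smul_mem c ha
    | lie a b _ _ ha hb =>
      rw [leibniz_lie, ← lie_skew]
      exact add_mem (neg_mem (J.lie_mem ha)) (J.lie_mem hb)
  exact (LieSubmodule.lie_le_iff _ _ _).2 fun x _ y _ => h2 x y

theorem FreeLieAlgebra.lieSpan_range_of (R X : Type*) [CommRing R] :
    LieSubalgebra.lieSpan R (FreeLieAlgebra R X) (Set.range (of R)) = ⊤ := by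
  set S := LieSubalgebra.lieSpan R (FreeLieAlgebra R X) (Set.range (of R))
  let F : FreeLieAlgebra R X →ₗ⁅R⁆ S :=
    lift R fun i => ⟨of R i, LieSubalgebra.subset_lieSpan ⟨i, rfl⟩⟩
  have hF : S.incl.comp F = LieHom.id := by
    ext i
    simp [F]
  rw [eq_top_iff]
  intro x _
  have := congrArg (fun G : FreeLieAlgebra R X →ₗ⁅R⁆ FreeLieAlgebra R X => G x) hF
  simp only [LieHom.comp_apply, LieHom.id_apply] at this
  rw [← this]
  exact (F x).2

/-- Pairs over a commutative ring `R`, viewed as the Lie algebra of `2 × 2` matrices over `R`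
with zero second row. -/
def FoxPair (R : Type*) : Type _ := R × R

namespace FoxPair

variable {R : Type*} [CommRing R]

instance : AddCommGroup (FoxPair R) := inferInstanceAs (AddCommGroup (R × R))

instance {K : Type*} [CommRing K] [Algebra K R] : Module K (FoxPair R) :=
  inferInstanceAs (Module K (R × R))

instance : Bracket (FoxPair R) (FoxPair R) := ⟨fun x y => (0, x.1 * y.2 - y.1 * x.2)⟩

@[simp] theorem lie_fst (x y : FoxPair R) : ⁅x, y⁆.1 = 0 := rfl

@[simp] theorem lie_snd (x y : FoxPair R) : ⁅x, y⁆.2 = x.1 * y.2 - y.1 * x.2 := rfl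

@[simp] theorem add_fst (x y : FoxPair R) : (x + y).1 = x.1 + y.1 := rfl

@[simp] theorem add_snd (x y : FoxPair R) : (x + y).2 = x.2 + y.2 := rfl

@[simp] theorem zero_fst : (0 : FoxPair R).1 = 0 := rfl

@[simp] theorem zero_snd : (0 : FoxPair R).2 = 0 := rfl

@[simp] theorem smul_fst {K : Type*} [CommRing K] [Algebra K R] (c : K) (x : FoxPair R) :
    (c • x).1 = c • x.1 := rfl

@[simp] theorem smul_snd {K : Type*} [CommRing K] [Algebra K R] (c : K) (x : FoxPair R) :
    (c • x).2 = c • x.2 := rfl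

instance : LieRing (FoxPair R) where
  add_lie x y z := Prod.ext (by simp) (by simp; ring)
  lie_add x y z := Prod.ext (by simp) (by simp; ring)
  lie_self x := Prod.ext (by simp) (by simp)
  leibniz_lie x y z := Prod.ext (by simp) (by simp; ring)

instance {K : Type*} [CommRing K] [Algebra K R] : LieAlgebra K (FoxPair R) where
  lie_smul c x y := Prod.ext (by simp) (by simp [smul_sub])

theorem fst_eq_zero_of_mem_derivedSeries {K : Type*} [CommRing K] [Algebra K R] {x : FoxPair R}
    (hx : x ∈ LieAlgebra.derivedSeries K (FoxPair R) 1) : x.1 = 0 := by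
  let J : LieIdeal K (FoxPair R) :=
    { carrier := {x | x.1 = 0}
      add_mem' := fun {a b} (ha : a.1 = 0) (hb : b.1 = 0) => by simp [ha, hb]
      zero_mem' := rfl
      smul_mem' := fun c a (ha : a.1 = 0) => by simp [ha]
      lie_mem := fun _ => rfl }
  have h : LieAlgebra.derivedSeries K (FoxPair R) 1 ≤ J :=
    (LieSubmodule.lie_le_iff _ _ _).2 fun _ _ _ _ => rfl
  exact h hx

theorem derivedSeries_two (K : Type*) [CommRing K] [Algebra K R] :
    LieAlgebra.derivedSeries K (FoxPair R) 2 = ⊥ := by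
  refine le_bot_iff.1 ((LieSubmodule.lie_le_iff _ _ _).2 fun x hx y hy => ?_)
  rw [LieSubmodule.mem_bot]
  exact Prod.ext rfl (by
    simp [fst_eq_zero_of_mem_derivedSeries hx, fst_eq_zero_of_mem_derivedSeries hy])

end FoxPair

namespace FreeMetabelianLie

variable {K : Type} [Field K] {n : ℕ}

variable (K n) in
/-- The projection from the free Lie algebra to the free metabelian Lie algebra. -/
noncomputable def proj : FreeLieAlgebra K (Fin n) →ₗ⁅K⁆ FreeMetabelianLie K n where
  toLinearMap := (LieAlgebra.derivedSeries K (FreeLieAlgebra K (Fin n)) 2).toSubmodule.mkQ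
  map_lie' := rfl

theorem proj_surjective : Function.Surjective (proj K n) := Submodule.mkQ_surjective _

theorem induction {p : FreeMetabelianLie K n → Prop} (gen : ∀ i, p (xg K n i)) (zero : p 0)
    (add : ∀ x y, p x → p y → p (x + y)) (smul : ∀ (c : K) x, p x → p (c • x))
    (lie : ∀ x y, p x → p y → p ⁅x, y⁆) (x : FreeMetabelianLie K n) : p x := by
  obtain ⟨y, rfl⟩ := proj_surjective x
  have hy : y ∈ LieSubalgebra.lieSpan K (FreeLieAlgebra K (Fin n))
      (Set.range (FreeLieAlgebra.of K)) :=
    FreeLieAlgebra.lieSpan_range_of K (Fin n) ▸ LieSubalgebra.mem_top y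
  induction hy using LieSubalgebra.lieSpan_induction with
  | mem y hy =>
    obtain ⟨i, rfl⟩ := hy
    exact gen i
  | zero => rwa [map_zero]
  | add a b _ _ ha hb => rw [map_add]; exact add _ _ ha hb
  | smul c a _ ha => rw [map_smul]; exact smul _ _ ha
  | lie a b _ _ ha hb => rw [LieHom.map_lie]; exact lie _ _ ha hb

variable (K n) in
theorem lieSpan_range_xg :
    LieSubalgebra.lieSpan K (FreeMetabelianLie K n) (Set.range (xg K n)) = ⊤ := by
  refine eq_top_iff.2 fun x _ => ?_
  induction x using FreeMetabelianLie.induction with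
  | gen i => exact LieSubalgebra.subset_lieSpan ⟨i, rfl⟩
  | zero => exact zero_mem _
  | add x y hx hy => exact add_mem (hx trivial) (hy trivial)
  | smul c x hx => exact SMulMemClass.smul_mem c (hx trivial)
  | lie x y hx hy => exact LieSubalgebra.lie_mem _ (hx trivial) (hy trivial)

variable (K n) in
theorem derivedSeries_two : LieAlgebra.derivedSeries K (FreeMetabelianLie K n) 2 = ⊥ := by
  rw [← LieIdeal.derivedSeries_map_eq 2 (proj_surjective (K := K) (n := n)),
    LieIdeal.map_eq_bot_iff]
  intro x hx
  rw [LieHom.mem_ker]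
  exact (LieSubmodule.Quotient.mk_eq_zero' (R := K)).2 hx

theorem lie_eq_zero {a b : FreeMetabelianLie K n}
    (ha : a ∈ LieAlgebra.derivedSeries K (FreeMetabelianLie K n) 1)
    (hb : b ∈ LieAlgebra.derivedSeries K (FreeMetabelianLie K n) 1) : ⁅a, b⁆ = 0 := by
  have h : ⁅a, b⁆ ∈ LieAlgebra.derivedSeries K (FreeMetabelianLie K n) 2 :=
    LieSubmodule.lie_mem_lie ha hb
  rwa [derivedSeries_two, LieSubmodule.mem_bot] at h

theorem lie_mem_derivedSeries (a b : FreeMetabelianLie K n) :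
    ⁅a, b⁆ ∈ LieAlgebra.derivedSeries K (FreeMetabelianLie K n) 1 :=
  LieSubmodule.lie_mem_lie (LieSubmodule.mem_top a) (LieSubmodule.mem_top b)

/-- The universal property of the free metabelian Lie algebra. -/
theorem exists_lieHom {L : Type*} [LieRing L] [LieAlgebra K L]
    (hL : LieAlgebra.derivedSeries K L 2 = ⊥) (g : Fin n → L) :
    ∃ F : FreeMetabelianLie K n →ₗ⁅K⁆ L, ∀ i, F (xg K n i) = g i := by
  have h : ∀ x ∈ LieAlgebra.derivedSeries K (FreeLieAlgebra K (Fin n)) 2,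
      FreeLieAlgebra.lift K g x = 0 := by
    intro x hx
    have := LieIdeal.derivedSeries_map_le (f := FreeLieAlgebra.lift K g) 2 (LieIdeal.mem_map hx)
    rwa [hL, LieSubmodule.mem_bot] at this
  refine ⟨{ toLinearMap := Submodule.liftQ _ (FreeLieAlgebra.lift K g).toLinearMap h
            map_lie' := ?_ }, fun i => FreeLieAlgebra.lift_of_apply g i⟩
  intro x y
  obtain ⟨x, rfl⟩ := proj_surjective x
  obtain ⟨y, rfl⟩ := proj_surjective y
  exact LieHom.map_lie (FreeLieAlgebra.lift K g) x y

theorem hom_ext {L : Type*} [LieRing L] [LieAlgebra K L] {F G : FreeMetabelianLie K n →ₗ⁅K⁆ L}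
    (h : ∀ i, F (xg K n i) = G (xg K n i)) : F = G := by
  ext x
  induction x using FreeMetabelianLie.induction with
  | gen i => exact h i
  | zero => simp
  | add x y hx hy => simp [hx, hy]
  | smul c x hx => simp [hx]
  | lie x y hx hy => simp [hx, hy]

/-- The homomorphism to `FoxPair` whose second component is the Fox derivative with respect to
the generator `x i₀`. -/
theorem exists_foxHom (i₀ : Fin n) :
    ∃ D : FreeMetabelianLie K n →ₗ⁅K⁆ FoxPair (MvPolynomial (Fin n) K),
      ∀ i, (D (xg K n i)).1 = MvPolynomial.X i ∧ (D (xg K n i)).2 = if i = i₀ then 1 else 0 := by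
  obtain ⟨D, hD⟩ := exists_lieHom (K := K) (FoxPair.derivedSeries_two K)
    fun i : Fin n => ((MvPolynomial.X i, if i = i₀ then 1 else 0) :
      MvPolynomial (Fin n) K × MvPolynomial (Fin n) K)
  exact ⟨D, fun i => ⟨congrArg Prod.fst (hD i), congrArg Prod.snd (hD i)⟩⟩

/-- The ideal generated by the brackets of the generators other than `x i₀`. -/
noncomputable abbrev otherBrackets (K : Type) [Field K] {n : ℕ} (i₀ : Fin n) :
    LieIdeal K (FreeMetabelianLie K n) :=
  LieSubmodule.lieSpan K (FreeMetabelianLie K n)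
    {z : FreeMetabelianLie K n | ∃ s t : Fin n, s ≠ i₀ ∧ t ≠ i₀ ∧ z = ⁅xg K n s, xg K n t⁆}

theorem fox_fst_eq_zero {R : Type*} [CommRing R] [Algebra K R]
    (D : FreeMetabelianLie K n →ₗ⁅K⁆ FoxPair R) {m : FreeMetabelianLie K n}
    (hm : m ∈ LieAlgebra.derivedSeries K (FreeMetabelianLie K n) 1) : (D m).1 = 0 :=
  FoxPair.fst_eq_zero_of_mem_derivedSeries
    (LieIdeal.derivedSeries_map_le (f := D) 1 (LieIdeal.mem_map hm))

open MvPolynomial in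
/-- An element of the derived ideal with vanishing Fox derivative with respect to `x i₀` lies in
the ideal generated by the brackets of the other generators. -/
theorem mem_otherBrackets_of_fox_eq_zero {i₀ : Fin n}
    {D : FreeMetabelianLie K n →ₗ⁅K⁆ FoxPair (MvPolynomial (Fin n) K)}
    (hD : ∀ i, (D (xg K n i)).1 = X i ∧ (D (xg K n i)).2 = if i = i₀ then 1 else 0) {f : FreeMetabelianLie K n}
    (hf : f ∈ LieAlgebra.derivedSeries K (FreeMetabelianLie K n) 1) (hDf : (D f).2 = 0) :
    f ∈ otherBrackets K i₀ := by
  let Q : LieIdeal K (FreeMetabelianLie K n) :=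
    LieAlgebra.derivedSeries K (FreeMetabelianLie K n) 1
  let W : Submodule K Q := (otherBrackets K i₀).toSubmodule.comap Q.toSubmodule.subtype
  have mem_W (q : Q) : q ∈ W ↔ (q : FreeMetabelianLie K n) ∈ otherBrackets K i₀ := Iff.rfl
  obtain ⟨ρ, hρ⟩ := exists_algHom_of_commute (R := K)
    (fun i : Fin n => LieModule.toEnd K (FreeMetabelianLie K n) Q (xg K n i)) (by
      intro i j
      ext q : 1
      have h : ⁅⁅xg K n i, xg K n j⁆, q⁆ = 0 :=
        Subtype.ext (lie_eq_zero (lie_mem_derivedSeries _ _) q.2)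
      simp [leibniz_lie (xg K n i), h])
  replace hρ : ∀ i (q : Q), ρ (X i) q = ⁅xg K n i, q⁆ := fun i q => by rw [hρ]; rfl
  have hW : ∀ p, ∀ w ∈ W, ρ p w ∈ W := by
    intro p
    induction p using MvPolynomial.induction_on with
    | C c =>
      intro w hw
      rw [← algebraMap_eq, AlgHom.commutes, Module.algebraMap_end_apply]
      exact W.smul_mem c hw
    | add p q hp hq =>
      intro w hw
      rw [map_add]
      exact W.add_mem (hp w hw) (hq w hw)
    | mul_X p i hp =>
      intro w hw
      rw [map_mul, Module.End.mul_apply, hρ]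
      exact hp _ ((mem_W _).2 ((otherBrackets K i₀).lie_mem ((mem_W w).1 hw)))
  let v : Fin n → Q := fun t => ⟨⁅xg K n t, xg K n i₀⁆, lie_mem_derivedSeries _ _⟩
  have hbr : ∀ s ≠ i₀, ∀ t ≠ i₀, ⁅xg K n s, xg K n t⁆ ∈ otherBrackets K i₀ := fun s hs t ht =>
    LieSubmodule.subset_lieSpan ⟨s, t, hs, ht, rfl⟩
  obtain ⟨σ, hσ⟩ := exists_linearMap_of_koszul ρ W hW {t | t ≠ i₀} v (by
    intro s hs t ht
    rw [hρ, hρ, mem_W]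
    change ⁅xg K n s, ⁅xg K n t, xg K n i₀⁆⁆ - ⁅xg K n t, ⁅xg K n s, xg K n i₀⁆⁆ ∈ _
    rw [← lie_lie]
    exact lie_mem_left K _ _ _ _ (hbr s hs t ht))
  have hρD : ∀ (y : FreeMetabelianLie K n) (q : Q), ρ (D y).1 q = ⁅y, q⁆ := by
    intro y
    induction y using FreeMetabelianLie.induction with
    | gen i => intro q; rw [(hD i).1]; exact hρ i q
    | zero => simp
    | add x y hx hy => intro q; simp [hx, hy]
    | smul c x hx => intro q; simp [hx]
    | lie x y hx hy =>
      intro q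
      have h : ⁅⁅x, y⁆, q⁆ = 0 := Subtype.ext (lie_eq_zero (lie_mem_derivedSeries _ _) q.2)
      simp [h]
  let J : LieIdeal K (FreeMetabelianLie K n) :=
    { carrier := {m | ∃ h : m ∈ Q, ∀ p, σ (p * (D m).2) - ρ p ⟨m, h⟩ ∈ W}
      add_mem' := by
        rintro a b ⟨ha, ha'⟩ ⟨hb, hb'⟩
        refine ⟨add_mem ha hb, fun p => ?_⟩
        have h := W.add_mem (ha' p) (hb' p)
        rw [← add_sub_add_comm, ← map_add, ← map_add, ← mul_add] at h
        rw [map_add, FoxPair.add_snd]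
        exact h
      zero_mem' := by
        refine ⟨zero_mem _, fun p => ?_⟩
        have h : (⟨0, zero_mem Q⟩ : Q) = 0 := rfl
        rw [h, map_zero, FoxPair.zero_snd, mul_zero, map_zero, map_zero, sub_zero]
        exact W.zero_mem
      smul_mem' := by
        rintro c a ⟨ha, ha'⟩
        refine ⟨Q.smul_mem c ha, fun p => ?_⟩
        have h := W.smul_mem c (ha' p)
        rw [smul_sub, ← map_smul, ← map_smul, ← mul_smul_comm] at h
        rw [map_smul, FoxPair.smul_snd]
        exact h
      lie_mem := by
        rintro x m ⟨hm, hm'⟩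
        refine ⟨Q.lie_mem hm, fun p => ?_⟩
        have h := hm' (p * (D x).1)
        rw [map_mul ρ, Module.End.mul_apply, hρD, mul_assoc] at h
        rw [LieHom.map_lie, FoxPair.lie_snd, fox_fst_eq_zero D hm, zero_mul, sub_zero]
        exact h }
  have hgen : ∀ i, i ≠ i₀ → ⁅xg K n i, xg K n i₀⁆ ∈ J := by
    intro i hi
    refine ⟨lie_mem_derivedSeries _ _, fun p => ?_⟩
    have h := hσ i hi p
    have h' : (D ⁅xg K n i, xg K n i₀⁆).2 = X i := by simp [hD, hi]
    rwa [h']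
  have hJ : Q ≤ J := by
    refine LieIdeal.derivedSeries_one_le_of_lie_mem (lieSpan_range_xg K n) J ?_
    rintro _ ⟨i, rfl⟩ _ ⟨j, rfl⟩
    by_cases hi : i = i₀
    · subst hi
      by_cases hj : j = i
      · rw [hj, lie_self]
        exact zero_mem J
      · rw [← lie_skew]
        exact neg_mem (hgen j hj)
    · by_cases hj : j = i₀
      · subst hj
        exact hgen i hi
      · refine ⟨lie_mem_derivedSeries _ _, fun p => ?_⟩
        have h : (D ⁅xg K n i, xg K n j⁆).2 = 0 := by
          simp [hD, hi, hj]
        rw [h, mul_zero, map_zero, zero_sub]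
        exact W.neg_mem (hW p _ (hbr i hi j hj))
  obtain ⟨_, h⟩ := hJ hf
  have h1 := h 1
  rw [hDf, mul_zero, map_zero, zero_sub, map_one, Module.End.one_apply] at h1
  exact (mem_W _).1 (neg_mem_iff.1 h1)

section OneRow

variable {f : FreeMetabelianLie K n} {i₀ : Fin n}
  {φ : FreeMetabelianLie K n →ₗ⁅K⁆ FreeMetabelianLie K n}

open MvPolynomial in
theorem mem_otherBrackets_of_surjective
    (hf : f ∈ LieAlgebra.derivedSeries K (FreeMetabelianLie K n) 1)
    (hφ0 : φ (xg K n i₀) = xg K n i₀ + f) (hφ : ∀ j, j ≠ i₀ → φ (xg K n j) = xg K n j)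
    (hs : Function.Surjective φ) : f ∈ otherBrackets K i₀ := by
  obtain ⟨D, hD⟩ := exists_foxHom (K := K) i₀
  refine mem_otherBrackets_of_fox_eq_zero hD hf ?_
  have chain : ∀ m, (D (φ m)).1 = (D m).1 ∧ (D (φ m)).2 = (1 + (D f).2) * (D m).2 := by
    intro m
    induction m using FreeMetabelianLie.induction with
    | gen i =>
      by_cases hi : i = i₀
      · subst hi
        simp [hφ0, hD, fox_fst_eq_zero D hf]
      · simp [hφ i hi, hD, hi]
    | zero => simp
    | add x y hx hy => simp [hx, hy, mul_add]
    | smul c x hx => simp [hx]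
    | lie x y hx hy =>
      refine ⟨by simp, ?_⟩
      simp only [LieHom.map_lie, FoxPair.lie_snd, hx, hy]
      ring
  have hconst : ∀ m, constantCoeff (D m).1 = 0 := by
    intro m
    induction m using FreeMetabelianLie.induction with
    | gen i => simp [hD]
    | zero => simp
    | add x y hx hy => simp [hx, hy]
    | smul c x hx => simp [hx]
    | lie x y hx hy => simp
  have hconst' : constantCoeff (D f).2 = 0 := by
    have hf' : f ∈ Submodule.span K {⁅x, y⁆ | (x : FreeMetabelianLie K n) (y)} := by
      rw [← LieAlgebra.coe_derivedSeries_one_eq]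
      exact hf
    clear hφ0 chain hf
    induction hf' using Submodule.span_induction with
    | mem _ h =>
      obtain ⟨x, y, rfl⟩ := h
      simp [hconst]
    | zero => simp
    | add x y _ _ hx hy => simp [hx, hy]
    | smul c x _ hx => simp [hx]
  obtain ⟨m, hm⟩ := hs (xg K n i₀)
  have h1 : (1 + (D f).2) * (D m).2 = 1 := by
    rw [← (chain m).2, hm]
    simp [hD]
  obtain ⟨r, -, hr⟩ := isUnit_iff_eq_C_of_isReduced.1 (IsUnit.of_mul_eq_one _ h1)
  have hr' := congrArg constantCoeff hr
  rw [map_add, hconst', map_one, add_zero, constantCoeff_C] at hr'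
  rwa [← hr', C_1, add_eq_left] at hr

theorem apply_eq_self_of_mem_otherBrackets
    (hf : f ∈ LieAlgebra.derivedSeries K (FreeMetabelianLie K n) 1)
    (hφ0 : φ (xg K n i₀) = xg K n i₀ + f) (hφ : ∀ j, j ≠ i₀ → φ (xg K n j) = xg K n j)
    {m : FreeMetabelianLie K n} (hm : m ∈ otherBrackets K i₀) : φ m = m := by
  have hsub : ∀ y, φ y - y ∈ LieAlgebra.derivedSeries K (FreeMetabelianLie K n) 1 := by
    intro y
    induction y using FreeMetabelianLie.induction with
    | gen i =>
      by_cases hi : i = i₀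
      · subst hi
        simpa [hφ0] using hf
      · simp [hφ i hi]
    | zero => simp
    | add x y hx hy => rw [map_add, add_sub_add_comm]; exact add_mem hx hy
    | smul c x hx => rw [map_smul, ← smul_sub]; exact SMulMemClass.smul_mem c hx
    | lie x y _ _ =>
      rw [LieHom.map_lie]
      exact sub_mem (lie_mem_derivedSeries _ _) (lie_mem_derivedSeries _ _)
  refine (?_ : m ∈ LieAlgebra.derivedSeries K (FreeMetabelianLie K n) 1 ∧ φ m = m).2
  induction hm using LieSubmodule.lieSpan_induction with
  | mem _ h =>
    obtain ⟨s, t, hs, ht, rfl⟩ := h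
    exact ⟨lie_mem_derivedSeries _ _, by rw [LieHom.map_lie, hφ s hs, hφ t ht]⟩
  | zero => simp
  | add x y _ _ hx hy => exact ⟨add_mem hx.1 hy.1, by rw [map_add, hx.2, hy.2]⟩
  | smul c x _ hx => exact ⟨SMulMemClass.smul_mem c hx.1, by rw [map_smul, hx.2]⟩
  | lie y x _ hx =>
    refine ⟨lie_mem_derivedSeries _ _, ?_⟩
    rw [LieHom.map_lie, hx.2, ← sub_eq_zero, ← sub_lie]
    exact lie_eq_zero (hsub y) hx.1

theorem bijective_of_mem_otherBrackets
    (hf : f ∈ LieAlgebra.derivedSeries K (FreeMetabelianLie K n) 1)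
    (hφ0 : φ (xg K n i₀) = xg K n i₀ + f) (hφ : ∀ j, j ≠ i₀ → φ (xg K n j) = xg K n j)
    (hfI : f ∈ otherBrackets K i₀) : Function.Bijective φ := by
  obtain ⟨ψ, hψ⟩ := exists_lieHom (derivedSeries_two K n)
    fun i => if i = i₀ then xg K n i₀ + -f else xg K n i
  have hψ0 : ψ (xg K n i₀) = xg K n i₀ + -f := by simp [hψ]
  have hψ' : ∀ j, j ≠ i₀ → ψ (xg K n j) = xg K n j := fun j hj => by simp [hψ, hj]
  have hφf := apply_eq_self_of_mem_otherBrackets hf hφ0 hφ hfI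
  have hψf := apply_eq_self_of_mem_otherBrackets (neg_mem hf) hψ0 hψ' hfI
  have h1 : ψ.comp φ = LieHom.id := hom_ext fun i => by
    by_cases hi : i = i₀
    · subst hi
      simp [hφ0, hψ0, hψf]
    · simp [hφ i hi, hψ' i hi]
  have h2 : φ.comp ψ = LieHom.id := hom_ext fun i => by
    by_cases hi : i = i₀
    · subst hi
      simp [hφ0, hψ0, hφf]
    · simp [hφ i hi, hψ' i hi]
  exact Function.bijective_iff_has_inverse.2
    ⟨ψ, fun x => LieHom.congr_fun h1 x, fun x => LieHom.congr_fun h2 x⟩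

end OneRow

end FreeMetabelianLie

/-- **Lemma 4.** Over a field `K` with `n ≥ 2`, for `f ∈ [Mₙ,Mₙ]`, the endomorphism
`(x₁ + f, x₂, …, xₙ)` of `Mₙ` is an automorphism if and only if `f` belongs to the Lie ideal
of `Mₙ` generated by all `[xₛ,xₜ]` with `s, t ≠ 1`. -/
theorem chein_one_row_is_automorphism_iff (K : Type) [Field K] (n : ℕ) (hn : 2 ≤ n)
    (f : FreeMetabelianLie K n)
    (hf : f ∈ LieAlgebra.derivedSeries K (FreeMetabelianLie K n) 1)
    (i0 : Fin n) (h0 : (i0 : ℕ) = 0)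
    (φ : FreeMetabelianLie K n →ₗ⁅K⁆ FreeMetabelianLie K n)
    (hφ0 : φ (xg K n i0) = xg K n i0 + f)
    (hφ : ∀ j : Fin n, j ≠ i0 → φ (xg K n j) = xg K n j) :
    Function.Bijective φ ↔
      f ∈ LieSubmodule.lieSpan K (FreeMetabelianLie K n)
        {z : FreeMetabelianLie K n |
          ∃ s t : Fin n, s ≠ i0 ∧ t ≠ i0 ∧ z = ⁅xg K n s, xg K n t⁆} := by
  exact ⟨fun h => FreeMetabelianLie.mem_otherBrackets_of_surjective hf hφ0 hφ h.surjective,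
    FreeMetabelianLie.bijective_of_mem_otherBrackets hf hφ0 hφ⟩
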